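/- arXiv:2209.02534 — 2 statements merged into one kernel-verified Lean document; each statement's English description precedes it below -/
import Mathlib

section
/- Let Ω be a finite linearly ordered type, let G be a subgroup of Equiv.Perm Ω, and let L : List Ω be a nonempty list. Then the first entry of the minimal image of L under G (the lexicographically least element of {L.map σ : σ ∈ G}) equals the least element of the orbit {σ (L.head) : σ ∈ G} of the first entry of L under G. -/
/-- The minimal image of a list `L` under a subgroup `G` of the symmetric group on `Ω`:
the lexicographically least element of `{L.map σ : σ ∈ G}`. -/
noncomputable def minListImage {Ω : Type*} [Fintype Ω] [LinearOrder Ω]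
    (G : Subgroup (Equiv.Perm Ω)) (L : List Ω) : List Ω :=
  letI : Fintype G := Fintype.ofFinite G
  (Finset.univ.image (fun σ : G => L.map ⇑(σ : Equiv.Perm Ω))).min'
    (Finset.univ_nonempty.image _)

/-- The least element of the orbit `{σ x : σ ∈ G}` of a point `x : Ω` under `G`. -/
noncomputable def orbitMin {Ω : Type*} [Fintype Ω] [LinearOrder Ω]
    (G : Subgroup (Equiv.Perm Ω)) (x : Ω) : Ω :=
  letI : Fintype G := Fintype.ofFinite G
  (Finset.univ.image (fun σ : G => (σ : Equiv.Perm Ω) x)).min'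
    (Finset.univ_nonempty.image _)

/-- The minimal image of `L` under `G` is itself the image of `L` under some element of `G`. -/
theorem exists_map_eq_minListImage {Ω : Type*} [Fintype Ω] [LinearOrder Ω]
    (G : Subgroup (Equiv.Perm Ω)) (L : List Ω) : ∃ σ ∈ G, L.map ⇑σ = minListImage G L := by
  let : Fintype G := Fintype.ofFinite G
  obtain ⟨σ, -, hσ⟩ := Finset.mem_image.1 (Finset.min'_mem
    (Finset.univ.image fun σ : G => L.map ⇑(σ : Equiv.Perm Ω)) (Finset.univ_nonempty.image _))
  exact ⟨σ, σ.2, hσ⟩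

theorem minListImage_le {Ω : Type*} [Fintype Ω] [LinearOrder Ω]
    {G : Subgroup (Equiv.Perm Ω)} {σ : Equiv.Perm Ω} (hσ : σ ∈ G) (L : List Ω) :
    minListImage G L ≤ L.map ⇑σ := by
  let : Fintype G := Fintype.ofFinite G
  exact Finset.min'_le _ _ (Finset.mem_image_of_mem _ (Finset.mem_univ (⟨σ, hσ⟩ : G)))

/-- The least element of an orbit lies in the orbit. -/
theorem exists_apply_eq_orbitMin {Ω : Type*} [Fintype Ω] [LinearOrder Ω]
    (G : Subgroup (Equiv.Perm Ω)) (x : Ω) : ∃ σ ∈ G, σ x = orbitMin G x := by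
  let : Fintype G := Fintype.ofFinite G
  obtain ⟨σ, -, hσ⟩ := Finset.mem_image.1 (Finset.min'_mem
    (Finset.univ.image fun σ : G => (σ : Equiv.Perm Ω) x) (Finset.univ_nonempty.image _))
  exact ⟨σ, σ.2, hσ⟩

theorem orbitMin_le {Ω : Type*} [Fintype Ω] [LinearOrder Ω]
    {G : Subgroup (Equiv.Perm Ω)} {σ : Equiv.Perm Ω} (hσ : σ ∈ G) (x : Ω) :
    orbitMin G x ≤ σ x := by
  let : Fintype G := Fintype.ofFinite G
  exact Finset.min'_le _ _ (Finset.mem_image_of_mem _ (Finset.mem_univ (⟨σ, hσ⟩ : G)))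

theorem head_minListImage {Ω : Type*} [Fintype Ω] [LinearOrder Ω]
    (G : Subgroup (Equiv.Perm Ω)) (L : List Ω) (hL : L ≠ []) :
    (minListImage G L).head? = some (orbitMin G (L.head hL)) := by
  cases L with
  | nil => exact absurd rfl hL
  | cons x L =>
    obtain ⟨σ, hσ, hσL⟩ := exists_map_eq_minListImage G (x :: L)
    obtain ⟨τ, hτ, hτx⟩ := exists_apply_eq_orbitMin G x
    have hle : σ x :: L.map ⇑σ ≤ τ x :: L.map ⇑τ := hσL.trans_le (minListImage_le hτ (x :: L))
    have hx : σ x ≤ orbitMin G x :=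
      hτx ▸ (hle.lt_or_eq.elim List.head_le_of_lt fun h => (List.cons.inj h).1.le)
    rw [← hσL, List.map_cons, List.head?_cons, List.head_cons, hx.antisymm (orbitMin_le hσ x)]
end

section
/- Let Ω be a finite linearly ordered type, Λ a type of labels, and G a subgroup of Equiv.Perm Ω. Let Fixed be a function from labelled digraph stacks on Ω to List Ω that is equivariant: Fixed(σ • S) = (Fixed S).map σ for every permutation σ ∈ Equiv.Perm Ω and every stack S. Let F be a fixed point refiner for G, i.e. a function from List Ω to labelled digraph stacks such that for every L : List Ω and every k ∈ G with L.map k = L one has k • F(L) = F(L). Let S and T be labelled digraph stacks and g ∈ G with g • S = T. Suppose g_S, g_T ∈ G are such that (Fixed S).map g_S is the minimal image of Fixed S under G and (Fixed T).map g_T is the minimal image of Fixed T under G. Then g • (g_S⁻¹ • F((Fixed S).map g_S)) = g_T⁻¹ • F((Fixed T).map g_T); that is, the refiner Ref(S) := g_S⁻¹ • F((Fixed S).map g_S) satisfies Ref(S) mapped by g equals Ref(T), so Ref is a valid refiner for G. -/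
/-- The action of a permutation `σ` of `Ω` on a labelled digraph `D : Ω → Ω → Λ`
by relabelling vertices: `(σ • D) x y = D (σ⁻¹ x) (σ⁻¹ y)`. -/
def digraphSMul {Ω Λ : Type*} (σ : Equiv.Perm Ω) (D : Ω → Ω → Λ) : Ω → Ω → Λ :=
  fun x y => D (σ⁻¹ x) (σ⁻¹ y)

/-- The entrywise action of a permutation `σ` of `Ω` on a labelled digraph stack
(a list of labelled digraphs). -/
def stackSMul {Ω Λ : Type*} (σ : Equiv.Perm Ω) (S : List (Ω → Ω → Λ)) :
    List (Ω → Ω → Λ) :=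
  S.map (digraphSMul σ)

theorem stackSMul_mul {Ω Λ : Type*} (σ τ : Equiv.Perm Ω) (S : List (Ω → Ω → Λ)) :
    stackSMul (σ * τ) S = stackSMul σ (stackSMul τ S) := by
  simp only [stackSMul, List.map_map]
  congr 1

/-- The minimal image is constant on `G`-orbits. -/
theorem minListImage_map {Ω : Type*} [Fintype Ω] [LinearOrder Ω]
    (G : Subgroup (Equiv.Perm Ω)) (g : G) (L : List Ω) :
    minListImage G (L.map ⇑(g : Equiv.Perm Ω)) = minListImage G L := by
  unfold minListImage
  congr 1
  ext M
  simp only [Finset.mem_image, Finset.mem_univ, true_and, List.map_map]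
  constructor
  · rintro ⟨σ, rfl⟩
    exact ⟨σ * g, rfl⟩
  · rintro ⟨σ, rfl⟩
    refine ⟨σ * g⁻¹, ?_⟩
    congr 1
    funext x
    simp

theorem refiner_from_fixedPointRefiner_is_refiner {Ω Λ : Type*} [Fintype Ω] [LinearOrder Ω]
    (G : Subgroup (Equiv.Perm Ω))
    (Fixed : List (Ω → Ω → Λ) → List Ω)
    (hFixed : ∀ (σ : Equiv.Perm Ω) (S : List (Ω → Ω → Λ)),
      Fixed (stackSMul σ S) = (Fixed S).map ⇑σ)
    (F : List Ω → List (Ω → Ω → Λ))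
    (hF : ∀ (L : List Ω) (k : G), L.map ⇑(k : Equiv.Perm Ω) = L →
      stackSMul (k : Equiv.Perm Ω) (F L) = F L)
    (S T : List (Ω → Ω → Λ)) (g : G) (hg : stackSMul (g : Equiv.Perm Ω) S = T)
    (gS gT : G)
    (hgS : (Fixed S).map ⇑(gS : Equiv.Perm Ω) = minListImage G (Fixed S))
    (hgT : (Fixed T).map ⇑(gT : Equiv.Perm Ω) = minListImage G (Fixed T)) :
    stackSMul (g : Equiv.Perm Ω)
        (stackSMul (gS : Equiv.Perm Ω)⁻¹ (F ((Fixed S).map ⇑(gS : Equiv.Perm Ω)))) =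
      stackSMul (gT : Equiv.Perm Ω)⁻¹ (F ((Fixed T).map ⇑(gT : Equiv.Perm Ω))) := by
  have hT : Fixed T = (Fixed S).map ⇑(g : Equiv.Perm Ω) := by rw [← hg, hFixed]
  have hM : (Fixed T).map ⇑(gT : Equiv.Perm Ω) = (Fixed S).map ⇑(gS : Equiv.Perm Ω) := by
    rw [hgT, hgS, hT, minListImage_map]
  rw [hM]
  have hfix : ((Fixed S).map ⇑(gS : Equiv.Perm Ω)).map
      ⇑((gT * g * gS⁻¹ : G) : Equiv.Perm Ω) = (Fixed S).map ⇑(gS : Equiv.Perm Ω) := by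
    conv_rhs => rw [← hM, hT]
    simp only [List.map_map]
    congr 1
    funext x
    simp
  have hk := hF _ _ hfix
  conv_rhs => rw [← hk]
  rw [← stackSMul_mul, ← stackSMul_mul]
  congr 1
  simp [mul_assoc]
end
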